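/- Assume S_U ⊆ (0, ∞) and S_L ⊆ (0, ∞). Then Σ_{j=1}^k w_j Φ(f(A_j)) − log(B_U) ≤ ( max_{x ∈ S_U} (x − log x) )·1_K, and Σ_{j=1}^k w_j Φ(f(A_j)) − log(B_L) ≥ ( min_{x ∈ S_L} (x − log x) )·1_K, in the Loewner order, where log is applied to B_U and B_L via continuous functional calculus and 1_K is the identity operator on K. -/

import Mathlib

open ContinuousLinearMap in
/-- The Kantorovich constant `K(m', M', r)`, with the convention that it equals `1`
for `r = 0` and `r = 1`. -/
noncomputable def kantorovich (m M r : ℝ) : ℝ :=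
  if r = 0 ∨ r = 1 then 1 else
    ((m * M ^ r - M * m ^ r) / ((r - 1) * (M - m))) *
      (((r - 1) * (M ^ r - m ^ r)) / (r * (m * M ^ r - M * m ^ r))) ^ r

open ContinuousLinearMap Polynomial

theorem one_le_kantorovich {m M : ℝ} (hm : 0 < m) (hmM : m < M) (n : ℕ) :
    1 ≤ kantorovich m M (n : ℝ) := by
  unfold kantorovich
  split_ifs with h
  · exact le_rfl
  obtain ⟨h0, h1⟩ := not_or.mp h
  have hn : 2 ≤ n := by
    have h0' : n ≠ 0 := by exact_mod_cast h0
    have h1' : n ≠ 1 := by exact_mod_cast h1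
    omega
  have hM : 0 < M := hm.trans hmM
  simp only [Real.rpow_natCast]
  have hn1 : (0 : ℝ) < (n : ℝ) - 1 := by
    have : (2 : ℝ) ≤ n := by exact_mod_cast hn
    linarith
  have hn0 : (0 : ℝ) < n := by linarith
  have hdiff : 0 < M - m := sub_pos.mpr hmM
  have hpow : 0 < M ^ n - m ^ n := sub_pos.mpr (pow_lt_pow_left₀ hmM hm.le (by omega))
  have hcross : 0 < m * M ^ n - M * m ^ n := by
    obtain ⟨l, rfl⟩ : ∃ l, n = l + 1 := ⟨n - 1, by omega⟩
    have : m ^ l < M ^ l := pow_lt_pow_left₀ hmM hm.le (by omega)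
    have h2 : m * M ^ (l + 1) - M * m ^ (l + 1) = m * M * (M ^ l - m ^ l) := by ring
    rw [h2]
    exact mul_pos (mul_pos hm hM) (sub_pos.mpr this)
  set u := M * ((((n : ℝ) - 1) * (M ^ n - m ^ n)) / (n * (m * M ^ n - M * m ^ n))) with hu
  have hupos : 0 < u := by positivity
  have hbern : 1 + (n : ℝ) * (u - 1) ≤ u ^ n := by
    simpa using one_add_mul_le_pow (a := u - 1) (by linarith) n
  have hMn : 0 < M ^ n := pow_pos hM n
  have key : M ^ n ≤ (m * M ^ n - M * m ^ n) / (((n : ℝ) - 1) * (M - m)) * u ^ n := by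
    calc M ^ n = (m * M ^ n - M * m ^ n) / (((n : ℝ) - 1) * (M - m)) *
          (1 + (n : ℝ) * (u - 1)) := by
          have hne := hcross.ne'
          obtain ⟨D, hD⟩ : ∃ D, D = m * M ^ n - M * m ^ n := ⟨_, rfl⟩
          rw [hu]
          rw [← hD] at hne ⊢
          field_simp
          rw [hD]
          ring
      _ ≤ _ := by gcongr
  rw [hu, mul_pow, mul_left_comm] at key
  exact le_of_mul_le_mul_left (by simpa using key) hMn

section PolynomialBounds

variable {ι : Type*} (s : Finset ι) (a c d : ι → ℝ) (e : ι → ℕ) {x y z : ℝ}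

/-- Enlarging the terms with nonnegative coefficients and shrinking the others
increases a polynomial expression. -/
theorem sum_mul_pow_le_of_scaled (hc : ∀ i, 1 ≤ c i) (hd : ∀ i, 1 ≤ d i)
    (hx : 0 < x) (hxy : x ≤ y) (hyz : y ≤ z) :
    ∑ i ∈ s, a i * y ^ e i ≤
      (∑ i ∈ s.filter (fun i => 0 ≤ a i), a i * c i * z ^ e i) +
        ∑ i ∈ s.filter (fun i => a i < 0), a i * (d i)⁻¹ * x ^ e i := by
  rw [← Finset.sum_filter_add_sum_filter_not s (fun i => 0 ≤ a i)]
  simp only [not_le]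
  have hy : 0 < y := hx.trans_le hxy
  refine add_le_add (Finset.sum_le_sum fun i hi => ?_) (Finset.sum_le_sum fun i hi => ?_)
  · rw [mul_assoc]
    refine mul_le_mul_of_nonneg_left ?_ (Finset.mem_filter.mp hi).2
    calc y ^ e i ≤ z ^ e i := pow_le_pow_left₀ hy.le hyz _
      _ ≤ c i * z ^ e i := le_mul_of_one_le_left (pow_nonneg (hy.le.trans hyz) _) (hc i)
  · rw [mul_assoc]
    refine mul_le_mul_of_nonpos_left ?_ (Finset.mem_filter.mp hi).2.le
    calc (d i)⁻¹ * x ^ e i ≤ x ^ e i :=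
          mul_le_of_le_one_left (pow_nonneg hx.le _) (inv_le_one_of_one_le₀ (hd i))
      _ ≤ y ^ e i := pow_le_pow_left₀ hx.le hxy _

/-- Shrinking the terms with nonnegative coefficients and enlarging the others
decreases a polynomial expression. -/
theorem scaled_le_sum_mul_pow (hc : ∀ i, 1 ≤ c i) (hd : ∀ i, 1 ≤ d i)
    (hx : 0 < x) (hxy : x ≤ y) (hyz : y ≤ z) :
    (∑ i ∈ s.filter (fun i => 0 ≤ a i), a i * (d i)⁻¹ * x ^ e i) +
        ∑ i ∈ s.filter (fun i => a i < 0), a i * c i * z ^ e i ≤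
      ∑ i ∈ s, a i * y ^ e i := by
  rw [← Finset.sum_filter_add_sum_filter_not s (fun i => 0 ≤ a i)]
  simp only [not_le]
  have hy : 0 < y := hx.trans_le hxy
  refine add_le_add (Finset.sum_le_sum fun i hi => ?_) (Finset.sum_le_sum fun i hi => ?_)
  · rw [mul_assoc]
    refine mul_le_mul_of_nonneg_left ?_ (Finset.mem_filter.mp hi).2
    calc (d i)⁻¹ * x ^ e i ≤ x ^ e i :=
          mul_le_of_le_one_left (pow_nonneg hx.le _) (inv_le_one_of_one_le₀ (hd i))
      _ ≤ y ^ e i := pow_le_pow_left₀ hx.le hxy _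
  · rw [mul_assoc]
    refine mul_le_mul_of_nonpos_left ?_ (Finset.mem_filter.mp hi).2.le
    calc y ^ e i ≤ z ^ e i := pow_le_pow_left₀ hy.le hyz _
      _ ≤ c i * z ^ e i := le_mul_of_one_le_left (pow_nonneg (hy.le.trans hyz) _) (hc i)

end PolynomialBounds

theorem sInf_image_Icc_pos {g : ℝ → ℝ} {a b : ℝ} (hab : a ≤ b)
    (hg : ContinuousOn g (Set.Icc a b)) (hpos : ∀ x ∈ Set.Icc a b, 0 < g x) :
    0 < sInf (g '' Set.Icc a b) := by
  obtain ⟨x, hx, hxe⟩ := (isCompact_Icc.image_of_continuousOn hg).sInf_mem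
    ((Set.nonempty_Icc.mpr hab).image g)
  exact hxe ▸ hpos x hx

section Compression

variable {H K : Type*} [NormedAddCommGroup H] [InnerProductSpace ℂ H] [CompleteSpace H]
  [NormedAddCommGroup K] [InnerProductSpace ℂ K] [CompleteSpace K]
  {ι : Type*} [Fintype ι] {V : K →L[ℂ] H} {w : ι → ℝ}

theorem sum_smul_adjoint_conj_mono (hw : ∀ j, 0 ≤ w j)
    {X Y : ι → H →L[ℂ] H} (hXY : ∀ j, X j ≤ Y j) :
    ∑ j, w j • ((adjoint V) ∘L (X j) ∘L V) ≤ ∑ j, w j • ((adjoint V) ∘L (Y j) ∘L V) := by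
  refine Finset.sum_le_sum fun j _ => smul_le_smul_of_nonneg_left ?_ (hw j)
  rw [ContinuousLinearMap.le_def]
  have h := ((ContinuousLinearMap.le_def _ _).mp (hXY j)).adjoint_conj V
  simpa [ContinuousLinearMap.comp_sub, ContinuousLinearMap.sub_comp] using h

theorem sum_smul_adjoint_conj_algebraMap (hV : (adjoint V) ∘L V = 1) (hw1 : ∑ j, w j = 1)
    (c : ℝ) :
    ∑ j, w j • ((adjoint V) ∘L (algebraMap ℝ (H →L[ℂ] H) c) ∘L V) =
      algebraMap ℝ (K →L[ℂ] K) c := by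
  rw [← Finset.sum_smul, hw1, one_smul, Algebra.algebraMap_eq_smul_one,
    Algebra.algebraMap_eq_smul_one, ← hV]
  ext x
  simp

/-- A convex combination of compressions of the operators `q j (A j)` is self-adjoint, and its
spectrum lies in the closed convex hull of the images under `q j` of intervals containing the
spectra of the `A j`; this hull is compact. -/
theorem isSelfAdjoint_and_spectrum_subset_of_sum_conj [Nonempty ι]
    (hV : (adjoint V) ∘L V = 1) (hw : ∀ j, 0 ≤ w j) (hw1 : ∑ j, w j = 1)
    {m M : ι → ℝ} (hmM : ∀ j, m j < M j) {A : ι → H →L[ℂ] H} (hA : ∀ j, IsSelfAdjoint (A j))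
    (hspec : ∀ j, spectrum ℝ (A j) ⊆ Set.Icc (m j) (M j))
    {q : ι → ℝ → ℝ} (hq : ∀ j, Continuous (q j)) :
    IsSelfAdjoint (∑ j, w j • ((adjoint V) ∘L (cfc (q j) (A j)) ∘L V)) ∧
    spectrum ℝ (∑ j, w j • ((adjoint V) ∘L (cfc (q j) (A j)) ∘L V)) ⊆
      closure (convexHull ℝ (⋃ j, q j '' Set.Icc (m j) (M j))) ∧
    IsCompact (closure (convexHull ℝ (⋃ j, q j '' Set.Icc (m j) (M j)))) := by
  set T := ⋃ j, q j '' Set.Icc (m j) (M j) with hT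
  set S := closure (convexHull ℝ T) with hS
  have hTS : T ⊆ S := (subset_convexHull ℝ T).trans subset_closure
  have hTc : IsCompact T := isCompact_iUnion fun j => isCompact_Icc.image (hq j)
  have hSc : IsCompact S := (isBounded_convexHull.mpr hTc.isBounded).isCompact_closure
  have hSconv : Convex ℝ S := (convex_convexHull ℝ T).closure
  have hSne : S.Nonempty := by
    obtain ⟨j⟩ := ‹Nonempty ι›
    exact ⟨q j (m j), hTS (Set.mem_iUnion.mpr
      ⟨j, m j, Set.left_mem_Icc.mpr (hmM j).le, rfl⟩)⟩
  have hmem : ∀ j, ∀ x ∈ spectrum ℝ (A j), q j x ∈ S := fun j x hx =>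
    hTS (Set.mem_iUnion.mpr ⟨j, x, hspec j hx, rfl⟩)
  set B := ∑ j, w j • ((adjoint V) ∘L (cfc (q j) (A j)) ∘L V) with hB
  have hlow : algebraMap ℝ (K →L[ℂ] K) (sInf S) ≤ B := by
    rw [← sum_smul_adjoint_conj_algebraMap hV hw1]
    refine sum_smul_adjoint_conj_mono hw fun j => ?_
    exact algebraMap_le_cfc _ _ _ (fun x hx => csInf_le hSc.bddBelow (hmem j x hx))
      (hq j).continuousOn (hA j)
  have hup : B ≤ algebraMap ℝ (K →L[ℂ] K) (sSup S) := by
    rw [← sum_smul_adjoint_conj_algebraMap hV hw1]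
    refine sum_smul_adjoint_conj_mono hw fun j => ?_
    exact cfc_le_algebraMap _ _ _ (fun x hx => le_csSup hSc.bddAbove (hmem j x hx))
      (hq j).continuousOn (hA j)
  have hBsa : IsSelfAdjoint B := by
    have h1 := (IsSelfAdjoint.of_nonneg (sub_nonneg.mpr hlow)).add
      (IsSelfAdjoint.algebraMap (K →L[ℂ] K) (IsSelfAdjoint.all (sInf S)))
    simpa using h1
  refine ⟨hBsa, fun x hx => ?_, hSc⟩
  have hx1 := (algebraMap_le_iff_le_spectrum hBsa).mp hlow x hx
  have hx2 := (le_algebraMap_iff_spectrum_le hBsa).mp hup x hx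
  exact hSconv.ordConnected.out (hSc.sInf_mem hSne) (hSc.sSup_mem hSne) ⟨hx1, hx2⟩

end Compression

theorem sum_smul_cfc_pow {H : Type*} [NormedAddCommGroup H] [InnerProductSpace ℂ H]
    [CompleteSpace H] {A : H →L[ℂ] H} (hA : IsSelfAdjoint A) {f : ℝ → ℝ}
    (hf : ContinuousOn f (spectrum ℝ A)) (s : Finset ℕ) (a : ℕ → ℝ) :
    ∑ i ∈ s, a i • (cfc f A) ^ i = cfc (fun x => ∑ i ∈ s, a i * f x ^ i) A := by
  have hfun : (fun x => ∑ i ∈ s, a i * f x ^ i) = ∑ i ∈ s, fun x => a i * f x ^ i := by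
    ext x
    simp
  rw [hfun, cfc_sum (fun i x => a i * f x ^ i) A s (fun i _ => by fun_prop)]
  refine Finset.sum_congr rfl fun i _ => ?_
  rw [cfc_const_mul (a i) (fun x => f x ^ i) A (by fun_prop), cfc_pow f i A hf]

theorem sub_cfc_log_mem_bounds {K : Type*} [NormedAddCommGroup K] [InnerProductSpace ℂ K]
    [CompleteSpace K] {B : K →L[ℂ] K} (hB : IsSelfAdjoint B) {S : Set ℝ} (hS : IsCompact S)
    (hpos : S ⊆ Set.Ioi 0) (hBS : spectrum ℝ B ⊆ S) :
    sInf ((fun x => x - Real.log x) '' S) • (1 : K →L[ℂ] K) ≤ B - cfc Real.log B ∧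
      B - cfc Real.log B ≤ sSup ((fun x => x - Real.log x) '' S) • (1 : K →L[ℂ] K) := by
  have hlogS : ContinuousOn Real.log S :=
    Real.continuousOn_log.mono fun x hx => (hpos hx).ne'
  have hlog := hlogS.mono hBS
  have himg := hS.image_of_continuousOn (continuousOn_id.sub hlogS)
  have heq : B - cfc Real.log B = cfc (fun x => x - Real.log x) B := by
    rw [cfc_sub (fun x => x) Real.log B continuousOn_id hlog, cfc_id' ℝ B]
  have hcont : ContinuousOn (fun x => x - Real.log x) (spectrum ℝ B) :=
    continuousOn_id.sub hlog
  rw [heq, ← Algebra.algebraMap_eq_smul_one, ← Algebra.algebraMap_eq_smul_one]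
  exact ⟨algebraMap_le_cfc _ _ _
      (fun x hx => csInf_le himg.bddBelow ⟨x, hBS hx, rfl⟩) hcont hB,
    cfc_le_algebraMap _ _ _
      (fun x hx => le_csSup himg.bddAbove ⟨x, hBS hx, rfl⟩) hcont hB⟩

theorem stmt17
    {H K : Type*} [NormedAddCommGroup H] [InnerProductSpace ℂ H] [CompleteSpace H]
    [NormedAddCommGroup K] [InnerProductSpace ℂ K] [CompleteSpace K]
    (V : K →L[ℂ] H) (hV : (adjoint V) ∘L V = 1)
    (I : ℕ) (a : ℕ → ℝ)
    (k : ℕ) (hk : 1 ≤ k)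
    (w : Fin k → ℝ) (hw : ∀ j, 0 ≤ w j) (hw1 : ∑ j, w j = 1)
    (m M : Fin k → ℝ) (hmM : ∀ j, m j < M j)
    (A : Fin k → H →L[ℂ] H) (hA : ∀ j, IsSelfAdjoint (A j))
    (hspec : ∀ j, spectrum ℝ (A j) ⊆ Set.Icc (m j) (M j))
    (f : ℝ → ℝ) (hf : ContinuousOn f (⋃ j, Set.Icc (m j) (M j)))
    (pL pU : Polynomial ℝ)
    (hp : ∀ x ∈ ⋃ j, Set.Icc (m j) (M j),
      0 < pL.eval x ∧ pL.eval x ≤ f x ∧ f x ≤ pU.eval x)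
    (mU MU mL ML : Fin k → ℝ)
    (hmU : ∀ j, mU j = sInf ((fun x => pU.eval x) '' Set.Icc (m j) (M j)))
    (hMU : ∀ j, MU j = sSup ((fun x => pU.eval x) '' Set.Icc (m j) (M j)))
    (hmL : ∀ j, mL j = sInf ((fun x => pL.eval x) '' Set.Icc (m j) (M j)))
    (hML : ∀ j, ML j = sSup ((fun x => pL.eval x) '' Set.Icc (m j) (M j)))
    (hUlt : ∀ j, mU j < MU j) (hLlt : ∀ j, mL j < ML j)
    (qU qL : Fin k → ℝ → ℝ)
    (hqU : ∀ j x, qU j x =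
      (∑ i ∈ (Finset.range (I + 1)).filter (fun i => 0 ≤ a i),
        a i * kantorovich (mU j) (MU j) (i : ℝ) * (pU.eval x) ^ i) +
      ∑ i ∈ (Finset.range (I + 1)).filter (fun i => a i < 0),
        a i * (kantorovich (mL j) (ML j) (i : ℝ))⁻¹ * (pL.eval x) ^ i)
    (hqL : ∀ j x, qL j x =
      (∑ i ∈ (Finset.range (I + 1)).filter (fun i => 0 ≤ a i),
        a i * (kantorovich (mL j) (ML j) (i : ℝ))⁻¹ * (pL.eval x) ^ i) +
      ∑ i ∈ (Finset.range (I + 1)).filter (fun i => a i < 0),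
        a i * kantorovich (mU j) (MU j) (i : ℝ) * (pU.eval x) ^ i)
    (BU BL : K →L[ℂ] K)
    (hBU : BU = ∑ j, w j • ((adjoint V) ∘L (cfc (qU j) (A j)) ∘L V))
    (hBL : BL = ∑ j, w j • ((adjoint V) ∘L (cfc (qL j) (A j)) ∘L V))
    (SU SL : Set ℝ)
    (hSU : SU = closure (convexHull ℝ (⋃ j, qU j '' Set.Icc (m j) (M j))))
    (hSL : SL = closure (convexHull ℝ (⋃ j, qL j '' Set.Icc (m j) (M j))))
    (hSUpos : SU ⊆ Set.Ioi (0 : ℝ)) (hSLpos : SL ⊆ Set.Ioi (0 : ℝ)) :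
    ((∑ j, w j • ((adjoint V) ∘L (∑ i ∈ Finset.range (I + 1), a i • (cfc f (A j)) ^ i) ∘L V)) - cfc Real.log BU ≤
      (sSup ((fun x => x - Real.log x) '' SU)) • (1 : K →L[ℂ] K)) ∧
    (sInf ((fun x => x - Real.log x) '' SL)) • (1 : K →L[ℂ] K) ≤
      (∑ j, w j • ((adjoint V) ∘L (∑ i ∈ Finset.range (I + 1), a i • (cfc f (A j)) ^ i) ∘L V)) - cfc Real.log BL := by
  have : Nonempty (Fin k) := ⟨⟨0, hk⟩⟩
  have hmem : ∀ j, ∀ x ∈ Set.Icc (m j) (M j), x ∈ ⋃ j, Set.Icc (m j) (M j) :=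
    fun j x hx => Set.mem_iUnion.mpr ⟨j, hx⟩
  have hfj : ∀ j, ContinuousOn f (spectrum ℝ (A j)) := fun j =>
    hf.mono fun x hx => hmem j x (hspec j hx)
  have hmUpos : ∀ j, 0 < mU j := fun j => by
    rw [hmU j]
    refine sInf_image_Icc_pos (hmM j).le pU.continuous.continuousOn fun x hx => ?_
    obtain ⟨h1, h2, h3⟩ := hp x (hmem j x hx)
    linarith
  have hmLpos : ∀ j, 0 < mL j := fun j => by
    rw [hmL j]
    exact sInf_image_Icc_pos (hmM j).le pL.continuous.continuousOn
      fun x hx => (hp x (hmem j x hx)).1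
  have hKU := fun j (i : ℕ) => one_le_kantorovich (hmUpos j) (hUlt j) i
  have hKL := fun j (i : ℕ) => one_le_kantorovich (hmLpos j) (hLlt j) i
  have hqUc : ∀ j, Continuous (qU j) := fun j => by
    rw [funext (hqU j)]
    fun_prop
  have hqLc : ∀ j, Continuous (qL j) := fun j => by
    rw [funext (hqL j)]
    fun_prop
  obtain ⟨hBUsa, hBUspec, hSUc⟩ :=
    isSelfAdjoint_and_spectrum_subset_of_sum_conj hV hw hw1 hmM hA hspec hqUc
  obtain ⟨hBLsa, hBLspec, hSLc⟩ :=
    isSelfAdjoint_and_spectrum_subset_of_sum_conj hV hw hw1 hmM hA hspec hqLc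
  rw [← hBU] at hBUsa hBUspec
  rw [← hBL] at hBLsa hBLspec
  rw [← hSU] at hBUspec hSUc
  rw [← hSL] at hBLspec hSLc
  have hsum := fun j => sum_smul_cfc_pow (hA j) (hfj j) (Finset.range (I + 1)) a
  have hcont : ∀ j, ContinuousOn (fun x => ∑ i ∈ Finset.range (I + 1), a i * f x ^ i)
      (spectrum ℝ (A j)) := fun j => by
    have := hfj j
    fun_prop
  simp only [hsum]
  constructor
  · refine le_trans (sub_le_sub_right ?_ _)
      (sub_cfc_log_mem_bounds hBUsa hSUc hSUpos hBUspec).2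
    rw [hBU]
    refine sum_smul_adjoint_conj_mono hw fun j => ?_
    refine cfc_mono (fun x hx => ?_) (hcont j) (hqUc j).continuousOn
    obtain ⟨h1, h2, h3⟩ := hp x (hmem j x (hspec j hx))
    rw [hqU j x]
    exact sum_mul_pow_le_of_scaled _ a _ _ (fun i => i) (hKU j) (hKL j) h1 h2 h3
  · refine le_trans (sub_cfc_log_mem_bounds hBLsa hSLc hSLpos hBLspec).1
      (sub_le_sub_right ?_ _)
    rw [hBL]
    refine sum_smul_adjoint_conj_mono hw fun j => ?_
    refine cfc_mono (fun x hx => ?_) (hqLc j).continuousOn (hcont j)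
    obtain ⟨h1, h2, h3⟩ := hp x (hmem j x (hspec j hx))
    rw [hqL j x]
    exact scaled_le_sum_mul_pow _ a _ _ (fun i => i) (hKU j) (hKL j) h1 h2 h3
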